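/- arXiv:1912.09355 — 2 statements merged into one kernel-verified Lean document; each statement's English description precedes it below -/
import Mathlib

section
/- For every positive integer m and every integer f > m with m not dividing f, writing f = mq + r with 0 < r < m, the number of numerical sets T with f(T) = f and m(A(T)) = m is at most (q+2)^(r-1) · (q+1)^(m-r). -/
open Filter Topology Set

/-- A numerical set: a cofinite subset of ℕ containing 0, not all of ℕ. -/
def IsNumericalSet (T : Set ℕ) : Prop :=
  0 ∈ T ∧ Tᶜ.Finite ∧ Tᶜ.Nonempty

/-- A numerical semigroup: a numerical set closed under addition. -/
def IsNumericalSemigroup (S : Set ℕ) : Prop :=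
  IsNumericalSet S ∧ ∀ a ∈ S, ∀ b ∈ S, a + b ∈ S

/-- Frobenius number: the largest element of the complement. -/
noncomputable def frob (T : Set ℕ) : ℕ := sSup Tᶜ

/-- The associated semigroup `A(T) = {t | t + T ⊆ T}`. -/
def AT (T : Set ℕ) : Set ℕ := {t : ℕ | ∀ x ∈ T, t + x ∈ T}

/-- Multiplicity: the smallest positive element. -/
noncomputable def mult (S : Set ℕ) : ℕ := sInf {x | x ∈ S ∧ 0 < x}

/-- `R(S) = f(S) - m(S)` as an integer. -/
noncomputable def RVal (S : Set ℕ) : ℤ := (frob S : ℤ) - (mult S : ℤ)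

/-- `P(S)`: the number of numerical sets whose associated semigroup is `S`. -/
noncomputable def PCount (S : Set ℕ) : ℕ :=
  {T : Set ℕ | IsNumericalSet T ∧ AT T = S}.ncard

/-- The density `μ(S) = P(S) / 2^(f(S)-1)`. -/
noncomputable def density (S : Set ℕ) : ℝ :=
  (PCount S : ℝ) / 2 ^ (frob S - 1)

/-- The numerical semigroup `N(D,f) = {0} ∪ {f - l : l ∈ D} ∪ (f, ∞)`. -/
def NSet (D : Finset ℕ) (f : ℕ) : Set ℕ :=
  {0} ∪ (fun l => f - l) '' (D : Set ℕ) ∪ {x | f < x}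

/-- `B(D,f)`: numerical sets `T` with `f(T) = f` and
`A(T) ∩ [f - Max D, f - 1] = {f - l : l ∈ D}`. -/
def BSet (D : Finset ℕ) (f : ℕ) : Set (Set ℕ) :=
  {T | IsNumericalSet T ∧ frob T = f ∧
    AT T ∩ Set.Icc (f - D.sup id) (f - 1) = (fun l => f - l) '' (D : Set ℕ)}

/-- `A_D = |B(D, 2 Max D + 1)|`. -/
noncomputable def AConst (D : Finset ℕ) : ℕ :=
  (BSet D (2 * D.sup id + 1)).ncard

/-- `B_l(k,f) = {T ∈ B({k},f) : T ∩ [1,l] = ∅}`. -/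
def BlSet (l k f : ℕ) : Set (Set ℕ) :=
  {T | T ∈ BSet {k} f ∧ T ∩ Set.Icc 1 l = ∅}

/-- `C_{l,k}`. -/
noncomputable def CConst (l k : ℕ) : ℕ :=
  if l ≤ k then (BlSet l k (2 * k + 1)).ncard else (BlSet l k (l + k + 1)).ncard

/-- `G_l(f) = {T : A(T) = N_f, T ∩ [1,l] = ∅}`. -/
def GSet (l f : ℕ) : Set (Set ℕ) :=
  {T | IsNumericalSet T ∧ AT T = NSet ∅ f ∧ T ∩ Set.Icc 1 l = ∅}

theorem add_mem_of_mult_AT_eq {T : Set ℕ} {m : ℕ} (hm : 0 < m) (h : mult (AT T) = m) :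
    ∀ x ∈ T, m + x ∈ T := by
  have hne : {x | x ∈ AT T ∧ 0 < x}.Nonempty := by
    by_contra hcon
    rw [Set.not_nonempty_iff_eq_empty] at hcon
    simp only [mult, hcon, Nat.sInf_empty] at h
    omega
  have hmem := Nat.sInf_mem hne
  rw [show sInf {x | x ∈ AT T ∧ 0 < x} = m from h] at hmem
  exact hmem.1

theorem IsNumericalSet.frob_notMem {T : Set ℕ} (hT : IsNumericalSet T) : frob T ∉ T :=
  Nat.sSup_mem hT.2.2 hT.2.1.bddAbove

theorem IsNumericalSet.mem_of_frob_lt {T : Set ℕ} (hT : IsNumericalSet T) {x : ℕ}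
    (hx : frob T < x) : x ∈ T := by
  by_contra hcon
  exact absurd (le_csSup hT.2.1.bddAbove hcon) (not_le.mpr hx)

/-- The least `k` such that `c + m * k` lies in `T`. -/
noncomputable def kunzCoord (m : ℕ) (T : Set ℕ) (c : ℕ) : ℕ := sInf {k | c + m * k ∈ T}

theorem add_mul_mem_of_le {T : Set ℕ} {m : ℕ} (h : ∀ x ∈ T, m + x ∈ T) {c k l : ℕ}
    (hkl : k ≤ l) (hk : c + m * k ∈ T) : c + m * l ∈ T := by
  induction l, hkl using Nat.le_induction with
  | base => exact hk
  | succ l _ ih =>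
    rw [show c + m * (l + 1) = m + (c + m * l) by ring]
    exact h _ ih

theorem add_mul_mem_iff {T : Set ℕ} {m : ℕ} (h : ∀ x ∈ T, m + x ∈ T) {c b : ℕ}
    (hb : c + m * b ∈ T) (k : ℕ) : c + m * k ∈ T ↔ kunzCoord m T c ≤ k := by
  have hmin : c + m * kunzCoord m T c ∈ T := Nat.sInf_mem (s := {k | c + m * k ∈ T}) ⟨b, hb⟩
  exact ⟨fun hk => Nat.sInf_le hk, fun hk => add_mul_mem_of_le h hk hmin⟩

theorem stmt1 (m f q r : ℕ) (hm : 0 < m) (hmf : m < f) (hdvd : ¬ m ∣ f)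
    (hfqr : f = m * q + r) (hr0 : 0 < r) (hrm : r < m) :
    {T : Set ℕ | IsNumericalSet T ∧ frob T = f ∧ mult (AT T) = m}.ncard
      ≤ (q + 2) ^ (r - 1) * (q + 1) ^ (m - r) := by
  let F : Set ℕ → (Fin (r - 1) → Fin (q + 2)) × (Fin (m - r) → Fin (q + 1)) := fun T =>
    (fun i => Fin.ofNat _ (kunzCoord m T (i + 1)),
      fun j => Fin.ofNat _ (kunzCoord m T (r + 1 + j)))
  have hcard : (Set.univ : Set ((Fin (r - 1) → Fin (q + 2)) ×
      (Fin (m - r) → Fin (q + 1)))).ncard = (q + 2) ^ (r - 1) * (q + 1) ^ (m - r) := by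
    simp [Set.ncard_univ]
  rw [← hcard]
  have hsucc : m * (q + 1) = m * q + m := by ring
  have low : ∀ T, IsNumericalSet T → frob T = f → ∀ c, 0 < c → c + m * (q + 1) ∈ T :=
    fun T hT hf c hc => hT.mem_of_frob_lt (by omega)
  have high : ∀ T, IsNumericalSet T → frob T = f → ∀ c, r < c → c + m * q ∈ T :=
    fun T hT hf c hc => hT.mem_of_frob_lt (by omega)
  refine Set.ncard_le_ncard_of_injOn F (fun _ _ => Set.mem_univ _) ?_ Set.finite_univ
  rintro T ⟨hT, hf, hA⟩ T' ⟨hT', hf', hA'⟩ hF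
  have hadd := add_mem_of_mult_AT_eq hm hA
  have hadd' := add_mem_of_mult_AT_eq hm hA'
  have hF1 := congrArg Prod.fst hF
  have hF2 := congrArg Prod.snd hF
  have hcoord : ∀ c, 0 < c → c ≤ m → kunzCoord m T c = kunzCoord m T' c := by
    intro c hc0 hcm
    have hl := low T hT hf c hc0
    have hl' := low T' hT' hf' c hc0
    have hb := (add_mul_mem_iff hadd hl _).1 hl
    have hb' := (add_mul_mem_iff hadd' hl' _).1 hl'
    rcases lt_trichotomy c r with hcr | rfl | hcr
    · have hval := congrArg Fin.val (congrFun hF1 ⟨c - 1, by omega⟩)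
      simp only [F, Fin.ofNat, Nat.sub_add_cancel hc0] at hval
      rwa [Nat.mod_eq_of_lt (by omega), Nat.mod_eq_of_lt (by omega)] at hval
    · have hn : c + m * q ∉ T := by
        rw [add_comm, ← hfqr, ← hf]
        exact hT.frob_notMem
      have hn' : c + m * q ∉ T' := by
        rw [add_comm, ← hfqr, ← hf']
        exact hT'.frob_notMem
      rw [add_mul_mem_iff hadd hl] at hn
      rw [add_mul_mem_iff hadd' hl'] at hn'
      omega
    · have hq := (add_mul_mem_iff hadd hl _).1 (high T hT hf c hcr)
      have hq' := (add_mul_mem_iff hadd' hl' _).1 (high T' hT' hf' c hcr)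
      have hval := congrArg Fin.val (congrFun hF2 ⟨c - (r + 1), by omega⟩)
      simp only [F, Fin.ofNat, Nat.add_sub_cancel' (Nat.succ_le_of_lt hcr)] at hval
      rwa [Nat.mod_eq_of_lt (by omega), Nat.mod_eq_of_lt (by omega)] at hval
  ext x
  rcases Nat.eq_zero_or_pos x with rfl | hx
  · exact iff_of_true hT.1 hT'.1
  · have hxm : x = ((x - 1) % m + 1) + m * ((x - 1) / m) := by
      have := Nat.mod_add_div (x - 1) m
      omega
    have hlt := Nat.mod_lt (x - 1) hm
    rw [hxm, add_mul_mem_iff hadd (low T hT hf _ (Nat.succ_pos _)),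
      add_mul_mem_iff hadd' (low T' hT' hf' _ (Nat.succ_pos _)),
      hcoord _ (Nat.succ_pos _) hlt]
end

section
/- Let l, k be positive integers with k ≥ l and let f ≥ 2k + 1. Then |B_l(k,f)| = C_{l,k} · 2^(f−2k−1). -/
open Filter Topology Set

/-- A numerical set with Frobenius number `f` is a set containing `0` and everything above `f`,
but not `f` itself. -/
lemma isNumericalSet_and_frob_eq_iff {T : Set ℕ} {f : ℕ} :
    IsNumericalSet T ∧ frob T = f ↔ 0 ∈ T ∧ f ∉ T ∧ ∀ x, f < x → x ∈ T := by
  constructor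
  · rintro ⟨⟨h0, hfin, hne⟩, rfl⟩
    refine ⟨h0, Nat.sSup_mem hne hfin.bddAbove, fun x hx => ?_⟩
    by_contra h
    exact absurd (le_csSup hfin.bddAbove (show x ∈ Tᶜ from h)) (not_le.mpr hx)
  · rintro ⟨h0, hf, hlarge⟩
    have hub : ∀ x ∈ Tᶜ, x ≤ f := fun x hx => not_lt.mp fun h => hx (hlarge x h)
    exact ⟨⟨h0, (Set.finite_Iic f).subset hub, ⟨f, hf⟩⟩,
      IsGreatest.csSup_eq ⟨hf, hub⟩⟩

/-- Membership of `f - i` in the associated semigroup only has to be tested on `[0, i]`. -/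
lemma sub_mem_AT_iff {T : Set ℕ} {f i : ℕ} (hi : i ≤ f) (hlarge : ∀ x, f < x → x ∈ T) :
    f - i ∈ AT T ↔ ∀ x ≤ i, x ∈ T → f - i + x ∈ T := by
  refine ⟨fun h x _ hx => h x hx, fun h x hx => ?_⟩
  by_cases hxi : x ≤ i
  · exact h x hxi hx
  · exact hlarge _ (by omega)

lemma mem_BlSet_iff {T : Set ℕ} {l k f : ℕ} (hk : 0 < k) (hf : k ≤ f) :
    T ∈ BlSet l k f ↔ 0 ∈ T ∧ f ∉ T ∧ (∀ x, f < x → x ∈ T) ∧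
      (∀ i, 0 < i → i ≤ k → ((∀ x ≤ i, x ∈ T → f - i + x ∈ T) ↔ i = k)) ∧
      ∀ x, 0 < x → x ≤ l → x ∉ T := by
  have hsmall : T ∩ Set.Icc 1 l = ∅ ↔ ∀ x, 0 < x → x ≤ l → x ∉ T :=
    Set.eq_empty_iff_forall_notMem.trans
      ⟨fun h x h1 h2 hx => h x ⟨hx, h1, h2⟩, fun h x hx => h x hx.2.1 hx.2.2 hx.1⟩
  have hsemi : (∀ x, f < x → x ∈ T) →
      (AT T ∩ Set.Icc (f - k) (f - 1) = {f - k} ↔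
        ∀ i, 0 < i → i ≤ k → ((∀ x ≤ i, x ∈ T → f - i + x ∈ T) ↔ i = k)) := by
    intro hlarge
    constructor
    · intro h i hi hik
      rw [← sub_mem_AT_iff (hik.trans hf) hlarge]
      have := Set.ext_iff.mp h (f - i)
      simp only [Set.mem_inter_iff, Set.mem_Icc, Set.mem_singleton_iff] at this
      constructor
      · intro hA
        have := this.mp ⟨hA, by omega, by omega⟩
        omega
      · rintro rfl
        exact (this.mpr rfl).1
    · intro h
      ext y
      simp only [Set.mem_inter_iff, Set.mem_Icc, Set.mem_singleton_iff]
      constructor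
      · rintro ⟨hA, h1, h2⟩
        obtain rfl | hf0 := Nat.eq_zero_or_pos f
        · omega
        obtain ⟨i, rfl, hi, hik⟩ : ∃ i, y = f - i ∧ 0 < i ∧ i ≤ k :=
          ⟨f - y, by omega, by omega, by omega⟩
        rw [sub_mem_AT_iff (hik.trans hf) hlarge, h i hi hik] at hA
        rw [hA]
      · rintro rfl
        exact ⟨(sub_mem_AT_iff hf hlarge).mpr ((h k hk le_rfl).mpr rfl), le_rfl, by omega⟩
  simp only [BlSet, BSet, Set.mem_ofPred_eq, Finset.sup_singleton, id, Finset.coe_singleton,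
    Set.image_singleton, hsmall]
  rw [← and_assoc, isNumericalSet_and_frob_eq_iff]
  constructor
  · rintro ⟨⟨⟨h0, hfT, hlarge⟩, h⟩, hs⟩
    exact ⟨h0, hfT, hlarge, (hsemi hlarge).mp h, hs⟩
  · rintro ⟨h0, hfT, hlarge, h, hs⟩
    exact ⟨⟨⟨h0, hfT, hlarge⟩, (hsemi hlarge).mpr h⟩, hs⟩

/-- The part of `U` above `k`, shifted up by `m`, together with the part of `U` in `[0, k]`
and the elements `k + 1 + y` for `y ∈ S`, `y < m`. -/
def insertBlock (k m : ℕ) (p : Set ℕ × Set ℕ) : Set ℕ :=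
  {x | x ≤ k ∧ x ∈ p.1 ∨ k < x ∧ x ≤ k + m ∧ x - (k + 1) ∈ p.2 ∨ k + m < x ∧ x - m ∈ p.1}

section insertBlock

variable {k m x : ℕ} {p : Set ℕ × Set ℕ}

lemma mem_insertBlock_of_le (hx : x ≤ k) : x ∈ insertBlock k m p ↔ x ∈ p.1 := by
  have h1 : ¬ k < x := by omega
  have h2 : ¬ k + m < x := by omega
  simp [insertBlock, hx, h1, h2]

lemma add_mem_insertBlock (hx : k < x) : x + m ∈ insertBlock k m p ↔ x ∈ p.1 := by
  have h1 : ¬ x + m ≤ k := by omega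
  have h2 : ¬ x + m ≤ k + m := by omega
  have h3 : k + m < x + m := by omega
  simp [insertBlock, h1, h2, h3]

lemma succ_add_mem_insertBlock (hx : x < m) : k + 1 + x ∈ insertBlock k m p ↔ x ∈ p.2 := by
  have h1 : ¬ k + 1 + x ≤ k := by omega
  have h2 : k < k + 1 + x := by omega
  have h3 : k + 1 + x ≤ k + m := by omega
  have h4 : ¬ k + m < k + 1 + x := by omega
  simp [insertBlock, h1, h2, h3, h4]

end insertBlock

lemma injOn_insertBlock (k m : ℕ) :
    Set.InjOn (insertBlock k m) (Set.univ ×ˢ 𝒫 (Set.Iio m)) := by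
  rintro ⟨U, S⟩ ⟨-, hS⟩ ⟨V, R⟩ ⟨-, hR⟩ h
  have h' := Set.ext_iff.mp h
  refine Prod.ext (Set.ext fun x => ?_) (Set.ext fun x => ?_)
  · by_cases hx : x ≤ k
    · simpa only [mem_insertBlock_of_le hx] using h' x
    · simpa only [add_mem_insertBlock (not_le.mp hx)] using h' (x + m)
  · by_cases hx : x < m
    · simpa only [succ_add_mem_insertBlock hx] using h' (k + 1 + x)
    · exact ⟨fun h => absurd (hS h) hx, fun h => absurd (hR h) hx⟩

lemma exists_insertBlock_eq (k m : ℕ) (T : Set ℕ) :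
    ∃ U, ∃ S ⊆ Set.Iio m, insertBlock k m (U, S) = T := by
  refine ⟨{x | x ≤ k ∧ x ∈ T ∨ k < x ∧ x + m ∈ T}, {x | x < m ∧ k + 1 + x ∈ T},
    fun x hx => hx.1, Set.ext fun x => ?_⟩
  by_cases h1 : x ≤ k
  · rw [mem_insertBlock_of_le h1]
    simp [h1, not_lt.mpr h1]
  by_cases h2 : x ≤ k + m
  · obtain ⟨y, rfl⟩ := Nat.exists_eq_add_of_le (not_le.mp h1)
    have hy : y < m := by omega
    exact (succ_add_mem_insertBlock hy).trans (by simp [hy])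
  · obtain ⟨y, rfl⟩ := Nat.exists_eq_add_of_le' (show m ≤ x by omega)
    have hy : k < y := by omega
    rw [add_mem_insertBlock hy]
    simp [hy, not_le.mpr hy]

lemma insertBlock_mem_BlSet_iff {l k : ℕ} (hk : 0 < k) (hlk : l ≤ k) (m : ℕ)
    (p : Set ℕ × Set ℕ) :
    insertBlock k m p ∈ BlSet l k (2 * k + 1 + m) ↔ p.1 ∈ BlSet l k (2 * k + 1) := by
  rw [mem_BlSet_iff hk (by omega), mem_BlSet_iff hk (by omega)]
  refine and_congr (mem_insertBlock_of_le (Nat.zero_le k)) <|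
    and_congr (not_congr (add_mem_insertBlock (by omega))) <| and_congr ?_ <| and_congr ?_ ?_
  · constructor
    · intro h x hx
      exact (add_mem_insertBlock (by omega)).mp (h (x + m) (by omega))
    · intro h x hx
      obtain ⟨y, rfl⟩ := Nat.exists_eq_add_of_le' (show m ≤ x by omega)
      exact (add_mem_insertBlock (by omega)).mpr (h y (by omega))
  · refine forall_congr' fun i => forall_congr' fun _ => forall_congr' fun hik =>
      iff_congr (forall_congr' fun x => forall_congr' fun hx => ?_) Iff.rfl
    rw [mem_insertBlock_of_le (hx.trans hik),
      show 2 * k + 1 + m - i + x = 2 * k + 1 - i + x + m by omega,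
      add_mem_insertBlock (by omega)]
  · exact forall_congr' fun x => forall_congr' fun _ => forall_congr' fun hx =>
      not_congr (mem_insertBlock_of_le (hx.trans hlk))

lemma image_insertBlock_BlSet {l k : ℕ} (hk : 0 < k) (hlk : l ≤ k) (m : ℕ) :
    insertBlock k m '' (BlSet l k (2 * k + 1) ×ˢ 𝒫 (Set.Iio m)) =
      BlSet l k (2 * k + 1 + m) := by
  ext T
  constructor
  · rintro ⟨p, ⟨hp, -⟩, rfl⟩
    exact (insertBlock_mem_BlSet_iff hk hlk m p).mpr hp
  · intro hT
    obtain ⟨U, S, hS, rfl⟩ := exists_insertBlock_eq k m T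
    exact ⟨(U, S), ⟨(insertBlock_mem_BlSet_iff hk hlk m _).mp hT, hS⟩, rfl⟩

theorem stmt7 (l k : ℕ) (hl : 0 < l) (hlk : l ≤ k) (f : ℕ) (hf : 2 * k + 1 ≤ f) :
    (BlSet l k f).ncard = CConst l k * 2 ^ (f - 2 * k - 1) := by
  obtain ⟨m, rfl⟩ := Nat.exists_eq_add_of_le hf
  rw [← image_insertBlock_BlSet (hl.trans_le hlk) hlk,
    Set.InjOn.ncard_image ((injOn_insertBlock k m).mono
      (Set.prod_mono (Set.subset_univ _) subset_rfl)),
    Set.ncard_prod, Set.ncard_powerset _ (Set.finite_Iio m), Set.ncard_Iio_nat, CConst, if_pos hlk]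
  congr 2
  omega
end
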